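/- Let G be a finite connected graph, Ã = A + I, D̃ its degree matrix, Â⊙ = D̃^{-1/2} Ã D̃^{-1/2}, and X ∈ ℝ^{n×d} any feature matrix. Then as k → ∞, the rows of Â⊙^k X converge, and the limiting i-th row is proportional to √D̃_{ii} times a fixed vector independent of i; consequently, for any two nodes i, j whose limiting rows are nonzero, the normalized limiting rows coincide (the smoothness distance D between them is 0). -/

import Mathlib

open Matrix Filter Finset

/-- A real Hermitian matrix whose eigenvalues lie in `(-1, 1]` has convergent powers. -/
theorem Matrix.IsHermitian.exists_tendsto_pow {ι : Type*} [Fintype ι] [DecidableEq ι]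
    {S : Matrix ι ι ℝ} (hS : S.IsHermitian)
    (h : ∀ (μ : ℝ) (v : ι → ℝ), v ≠ 0 → S *ᵥ v = μ • v → -1 < μ ∧ μ ≤ 1) :
    ∃ P : Matrix ι ι ℝ, Tendsto (fun k : ℕ => S ^ k) atTop (nhds P) := by
  have heig (i : ι) : -1 < hS.eigenvalues i ∧ hS.eigenvalues i ≤ 1 := by
    refine h _ _ (fun h0 => hS.eigenvectorBasis.orthonormal.ne_zero i ?_)
      (hS.mulVec_eigenvectorBasis i)
    ext j
    exact congrFun h0 j
  have hlim (i : ι) : ∃ l, Tendsto (fun k : ℕ => hS.eigenvalues i ^ k) atTop (nhds l) := by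
    rcases (heig i).2.eq_or_lt with h1 | h1
    · exact ⟨1, by simp [h1]⟩
    · exact ⟨0, tendsto_pow_atTop_nhds_zero_of_abs_lt_one (abs_lt.2 ⟨(heig i).1, h1⟩)⟩
  choose l hl using hlim
  refine ⟨(hS.eigenvectorUnitary : Matrix ι ι ℝ) * diagonal l *
    star (hS.eigenvectorUnitary : Matrix ι ι ℝ), ?_⟩
  have hpow (k : ℕ) : S ^ k = (hS.eigenvectorUnitary : Matrix ι ι ℝ) *
      diagonal (fun i => hS.eigenvalues i ^ k) *
      star (hS.eigenvectorUnitary : Matrix ι ι ℝ) := by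
    conv_lhs => rw [hS.spectral_theorem, ← map_pow, diagonal_pow]
    rfl
  simp_rw [hpow]
  have hdiag : Tendsto (fun k : ℕ => diagonal (fun i => hS.eigenvalues i ^ k)) atTop
      (nhds (diagonal l)) :=
    (continuous_id.matrix_diagonal.tendsto l).comp (tendsto_pi_nhds.2 hl)
  exact (hdiag.const_mul _).mul_const _

/-- The Dirichlet-type forms `∑ A i j (y i ± y j) ^ 2` at a generalized eigenvector `A y = μ d y`,
where `d` is the vector of row sums of the symmetric matrix `A`. -/
theorem sum_mul_add_mul_sq_of_eigen {ι : Type*} [Fintype ι] {A : Matrix ι ι ℝ} {d y : ι → ℝ}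
    {μ σ : ℝ} (hA : A.IsSymm) (hd : ∀ i, d i = ∑ j, A i j)
    (hy : ∀ i, ∑ j, A i j * y j = μ * (d i * y i)) (hσ : σ ^ 2 = 1) :
    ∑ i, ∑ j, A i j * (y i + σ * y j) ^ 2 = 2 * (1 + σ * μ) * ∑ i, d i * y i ^ 2 := by
  have hrow : ∑ i, ∑ j, A i j * y i ^ 2 = ∑ i, d i * y i ^ 2 := by
    simp_rw [hd, Finset.sum_mul]
  have hcol : ∑ i, ∑ j, A i j * y j ^ 2 = ∑ i, d i * y i ^ 2 := by
    rw [Finset.sum_comm, ← hrow]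
    simp_rw [hA.apply]
  have hcross : ∑ i, ∑ j, y i * (A i j * y j) = μ * ∑ i, d i * y i ^ 2 := by
    simp_rw [← Finset.mul_sum, hy, Finset.mul_sum]
    exact Finset.sum_congr rfl fun i _ => by ring
  calc ∑ i, ∑ j, A i j * (y i + σ * y j) ^ 2
      = ∑ i, ∑ j, (A i j * y i ^ 2 + A i j * y j ^ 2 + 2 * σ * (y i * (A i j * y j))) := by
        refine Finset.sum_congr rfl fun i _ => Finset.sum_congr rfl fun j _ => ?_
        linear_combination A i j * y j ^ 2 * hσ
    _ = _ := by
        simp_rw [Finset.sum_add_distrib, ← Finset.mul_sum] at hrow hcol hcross ⊢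
        rw [hrow, hcol, hcross]
        ring

namespace SimpleGraph

variable {ι : Type*} [DecidableEq ι] (G : SimpleGraph ι) [DecidableRel G.Adj]

theorem adjMatrix_add_one_nonneg (i j : ι) : 0 ≤ (G.adjMatrix ℝ + 1) i j := by
  rw [Matrix.add_apply, adjMatrix_apply, Matrix.one_apply]
  positivity

theorem adjMatrix_add_one_isSymm : (G.adjMatrix ℝ + 1).IsSymm :=
  G.isSymm_adjMatrix.add Matrix.isSymm_one

variable [Fintype ι]

theorem rowSum_adjMatrix_add_one_pos (i : ι) : 0 < ∑ j, (G.adjMatrix ℝ + 1) i j :=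
  Finset.sum_pos' (fun j _ => G.adjMatrix_add_one_nonneg i j) ⟨i, Finset.mem_univ i, by simp⟩

variable {G} {d y : ι → ℝ} {μ : ℝ}

/-- A generalized eigenvalue of `A + 1` with respect to its row sums lies in `(-1, 1]`. -/
theorem neg_one_lt_and_le_one_of_eigen (hd : ∀ i, d i = ∑ j, (G.adjMatrix ℝ + 1) i j)
    (hy : ∀ i, ∑ j, (G.adjMatrix ℝ + 1) i j * y j = μ * (d i * y i)) (hy0 : y ≠ 0) :
    -1 < μ ∧ μ ≤ 1 := by
  obtain ⟨i, hi⟩ := Function.ne_iff.1 hy0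
  have hdpos (j : ι) : 0 < d j := hd j ▸ G.rowSum_adjMatrix_add_one_pos j
  have hpos : 0 < ∑ i, d i * y i ^ 2 :=
    Finset.sum_pos' (fun j _ => mul_nonneg (hdpos j).le (sq_nonneg _))
      ⟨i, Finset.mem_univ i, mul_pos (hdpos i) (sq_pos_of_ne_zero hi)⟩
  have hterm (σ : ℝ) (j k : ι) : 0 ≤ (G.adjMatrix ℝ + 1) j k * (y j + σ * y k) ^ 2 :=
    mul_nonneg (G.adjMatrix_add_one_nonneg j k) (sq_nonneg _)
  constructor
  · have hsum := sum_mul_add_mul_sq_of_eigen (σ := 1) G.adjMatrix_add_one_isSymm hd hy (by norm_num)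
    have hlt : 0 < ∑ i, ∑ j, (G.adjMatrix ℝ + 1) i j * (y i + 1 * y j) ^ 2 := by
      refine Finset.sum_pos' (fun j _ => Finset.sum_nonneg fun k _ => hterm 1 j k)
        ⟨i, Finset.mem_univ i, Finset.sum_pos' (fun k _ => hterm 1 i k) ⟨i, Finset.mem_univ i, ?_⟩⟩
      have : y i + y i ≠ 0 := by simpa [← two_mul] using hi
      simpa using sq_pos_of_ne_zero this
    rw [hsum] at hlt
    linarith [pos_of_mul_pos_left hlt hpos.le]
  · have hsum := sum_mul_add_mul_sq_of_eigen (σ := -1) G.adjMatrix_add_one_isSymm hd hy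
      (by norm_num)
    have hle : 0 ≤ ∑ i, ∑ j, (G.adjMatrix ℝ + 1) i j * (y i + -1 * y j) ^ 2 :=
      Finset.sum_nonneg fun j _ => Finset.sum_nonneg fun k _ => hterm (-1) j k
    rw [hsum] at hle
    linarith [nonneg_of_mul_nonneg_left hle hpos]

/-- Over a connected graph, the generalized eigenvectors of `A + 1` for the eigenvalue `1` are
constant. -/
theorem Connected.eq_of_eigen_one (hG : G.Connected)
    (hd : ∀ i, d i = ∑ j, (G.adjMatrix ℝ + 1) i j)
    (hy : ∀ i, ∑ j, (G.adjMatrix ℝ + 1) i j * y j = d i * y i) (i j : ι) : y i = y j := by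
  have hterm (j k : ι) : 0 ≤ (G.adjMatrix ℝ + 1) j k * (y j + -1 * y k) ^ 2 :=
    mul_nonneg (G.adjMatrix_add_one_nonneg j k) (sq_nonneg _)
  have hsum : ∑ i, ∑ j, (G.adjMatrix ℝ + 1) i j * (y i + -1 * y j) ^ 2 = 0 := by
    rw [sum_mul_add_mul_sq_of_eigen (μ := 1) G.adjMatrix_add_one_isSymm hd (by simpa using hy)
      (by norm_num)]
    norm_num
  have hadj (a b : ι) (hab : G.Adj a b) : y a = y b := by
    rw [Finset.sum_eq_zero_iff_of_nonneg
      fun j _ => Finset.sum_nonneg fun k _ => hterm j k] at hsum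
    have h := (Finset.sum_eq_zero_iff_of_nonneg fun k _ => hterm a k).1
      (hsum a (Finset.mem_univ a)) b (Finset.mem_univ b)
    have h' : y a + -y b = 0 := by simpa [hab, hab.ne] using h
    linarith
  refine (hG.preconnected i j).elim fun p => ?_
  induction p with
  | nil => rfl
  | cons h _ ih => exact (hadj _ _ h).trans ih

end SimpleGraph

/-- For a connected graph, the rows of (D̃^{-1/2}ÃD̃^{-1/2})^k X converge; the
limiting i-th row is √(d i) times a fixed vector w independent of i, and the
(Euclidean-)normalized limiting rows of any two nodes with nonzero limits
coincide (smoothness distance 0). -/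
theorem stmt14 {n m : ℕ} (G : SimpleGraph (Fin n)) [DecidableRel G.Adj]
    (hconn : G.Connected)
    (Atil : Matrix (Fin n) (Fin n) ℝ) (hAtil : Atil = G.adjMatrix ℝ + 1)
    (d : Fin n → ℝ) (hd : ∀ i, d i = ∑ j, Atil i j)
    (S : Matrix (Fin n) (Fin n) ℝ)
    (hS : S = Matrix.diagonal (fun i => (Real.sqrt (d i))⁻¹) * Atil *
      Matrix.diagonal (fun i => (Real.sqrt (d i))⁻¹))
    (X : Matrix (Fin n) (Fin m) ℝ) :
    ∃ w : Fin m → ℝ,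
      (∀ i j, Filter.Tendsto (fun k : ℕ => ((S ^ k) * X) i j) Filter.atTop
        (nhds (Real.sqrt (d i) * w j))) ∧
      (∀ i i' : Fin n,
        (fun j => Real.sqrt (d i) * w j) ≠ (0 : Fin m → ℝ) →
        (fun j => Real.sqrt (d i') * w j) ≠ (0 : Fin m → ℝ) →
        (fun j => Real.sqrt (d i) * w j /
            Real.sqrt (∑ p, (Real.sqrt (d i) * w p) ^ 2)) =
        (fun j => Real.sqrt (d i') * w j /
            Real.sqrt (∑ p, (Real.sqrt (d i') * w p) ^ 2))) := by
  subst hAtil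
  have hdpos (i : Fin n) : 0 < d i := hd i ▸ G.rowSum_adjMatrix_add_one_pos i
  have hs (i : Fin n) : 0 < √(d i) := Real.sqrt_pos.2 (hdpos i)
  have hSapply (i j : Fin n) :
      S i j = (√(d i))⁻¹ * (G.adjMatrix ℝ + 1) i j * (√(d j))⁻¹ := by
    rw [hS, Matrix.mul_diagonal, Matrix.diagonal_mul]
  have hSherm : S.IsHermitian := by
    ext i j
    rw [Matrix.conjTranspose_apply, star_trivial, hSapply, hSapply,
      G.adjMatrix_add_one_isSymm.apply]
    ring
  have hgen (μ : ℝ) (v : Fin n → ℝ) (hv : S *ᵥ v = μ • v) (i : Fin n) :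
      ∑ j, (G.adjMatrix ℝ + 1) i j * (v j / √(d j)) = μ * (d i * (v i / √(d i))) := by
    have hvi : ∑ j, S i j * v j = μ * v i := congrFun hv i
    calc ∑ j, (G.adjMatrix ℝ + 1) i j * (v j / √(d j))
        = √(d i) * ∑ j, S i j * v j := by
          rw [Finset.mul_sum]
          refine Finset.sum_congr rfl fun j _ => ?_
          rw [hSapply]
          field_simp [(hs i).ne', (hs j).ne']
      _ = μ * (d i * (v i / √(d i))) := by
          rw [hvi]
          nth_rewrite 2 [← Real.mul_self_sqrt (hdpos i).le]
          field_simp [(hs i).ne']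
  obtain ⟨P, hP⟩ := hSherm.exists_tendsto_pow fun μ v hv0 hv =>
    SimpleGraph.neg_one_lt_and_le_one_of_eigen hd (hgen μ v hv) fun h0 => hv0 <| by
      funext i
      simpa [(hs i).ne'] using congrFun h0 i
  have hSP : S * P = P := by
    refine tendsto_nhds_unique (hP.const_mul S) ?_
    simp_rw [← pow_succ']
    exact hP.comp (tendsto_add_atTop_nat 1)
  have hfix (j : Fin m) : S *ᵥ (P * X).col j = (1 : ℝ) • (P * X).col j := by
    rw [one_smul]
    ext i
    conv_rhs => rw [← hSP, Matrix.mul_assoc]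
    rfl
  obtain ⟨i₀⟩ := hconn.nonempty
  obtain ⟨w, hw⟩ : ∃ w : Fin m → ℝ, ∀ i j, (P * X) i j = √(d i) * w j := by
    refine ⟨fun j => (P * X) i₀ j / √(d i₀), fun i j => ?_⟩
    have h : (P * X) i j / √(d i) = (P * X) i₀ j / √(d i₀) :=
      hconn.eq_of_eigen_one hd (y := fun i => (P * X).col j i / √(d i))
        (by simpa using hgen 1 _ (hfix j)) i i₀
    beta_reduce
    rw [← h, mul_div_cancel₀ _ (hs i).ne']
  refine ⟨w, fun i j => ?_, fun i i' _ _ => ?_⟩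
  · rw [← hw]
    have hPX : Tendsto (fun k : ℕ => S ^ k * X) atTop (nhds (P * X)) :=
      ((continuous_id.matrix_mul continuous_const).tendsto P).comp hP
    exact (hPX.apply_nhds i).apply_nhds j
  · have hnorm (i : Fin n) (j : Fin m) :
        √(d i) * w j / √(∑ p, (√(d i) * w p) ^ 2) = w j / √(∑ p, w p ^ 2) := by
      simp_rw [mul_pow, ← Finset.mul_sum]
      rw [Real.sqrt_mul (sq_nonneg _), Real.sqrt_sq (hs i).le,
        mul_div_mul_left _ _ (hs i).ne']
    exact funext fun j => (hnorm i j).trans (hnorm i' j).symm
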